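/- Let n > m ≥ 1 be integers. Let G be the group presented on generators a, b subject to the relations [b,a]^{2^m} = 1, [[b,a],a] = 1, [[b,a],b] = 1, a^{2^n} = 1, b^{2^m} = [b,a]^{2^{m−1}}, and let H be the group presented on generators x, y subject to the relations [y,x]^{2^m} = 1, [[y,x],x] = 1, [[y,x],y] = 1, x^{2^n} = 1, y^{2^m} = 1. Let U = Ω_m(G:G') = ⟨g ∈ G : g^{2^m} ∈ G'⟩ and V = Ω_m(H:H') = ⟨h ∈ H : h^{2^m} ∈ H'⟩. Then the subgroup ℧_m(U) = ⟨u^{2^m} : u ∈ U⟩ equals the subgroup generated by b^{2^m} and has order 2, while the subgroup ℧_m(V) = ⟨v^{2^m} : v ∈ V⟩ is trivial. -/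

import Mathlib

/-- The commutator `[x,y] = x⁻¹y⁻¹xy`. -/
def gpComm {G : Type*} [Group G] (x y : G) : G := x⁻¹ * y⁻¹ * x * y

/-- `Ω_m(G:N)` (with `q = 2^m`): the subgroup of `G` generated by all `g` with `g ^ q ∈ N`. -/
def omegaRel (q : ℕ) {G : Type*} [Group G] (N : Subgroup G) : Subgroup G :=
  Subgroup.closure {g | g ^ q ∈ N}

/-- `℧_m(P)` (with `q = 2^m`): the subgroup generated by the `q`-th powers of the elements
of the subgroup `P`. -/
def agemo (q : ℕ) {G : Type*} [Group G] (P : Subgroup G) : Subgroup G :=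
  Subgroup.closure {x | ∃ g ∈ P, x = g ^ q}

namespace ClassTwoCase3

/-- The free generators. -/
abbrev gen0 : FreeGroup (Fin 2) := FreeGroup.of 0
abbrev gen1 : FreeGroup (Fin 2) := FreeGroup.of 1

/-- Relators of `G`: `[b,a]^{2^m} = [[b,a],a] = [[b,a],b] = 1`, `a^{2^n} = 1`,
`b^{2^m} = [b,a]^{2^{m-1}}` (with `a = gen0`, `b = gen1`). -/
def Grels (n m : ℕ) : Set (FreeGroup (Fin 2)) :=
  {gpComm gen1 gen0 ^ 2 ^ m, gpComm (gpComm gen1 gen0) gen0, gpComm (gpComm gen1 gen0) gen1,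
    gen0 ^ 2 ^ n, gen1 ^ 2 ^ m * (gpComm gen1 gen0 ^ 2 ^ (m - 1))⁻¹}

/-- Relators of `H`: `[y,x]^{2^m} = [[y,x],x] = [[y,x],y] = 1`, `x^{2^n} = 1`, `y^{2^m} = 1`
(with `x = gen0`, `y = gen1`). -/
def Hrels (n m : ℕ) : Set (FreeGroup (Fin 2)) :=
  {gpComm gen1 gen0 ^ 2 ^ m, gpComm (gpComm gen1 gen0) gen0, gpComm (gpComm gen1 gen0) gen1,
    gen0 ^ 2 ^ n, gen1 ^ 2 ^ m}

/-- The presented group `G`. -/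
abbrev G (n m : ℕ) : Type := PresentedGroup (Grels n m)

/-- The presented group `H`. -/
abbrev H (n m : ℕ) : Type := PresentedGroup (Hrels n m)

/-- The image of the generator `b` in `G`. -/
abbrev bG (n m : ℕ) : G n m := PresentedGroup.of 1

end ClassTwoCase3

section ClassTwo

variable {K : Type*} [Group K]

theorem map_gpComm {L : Type*} [Group L] (f : K →* L) (x y : K) :
    f (gpComm x y) = gpComm (f x) (f y) := by
  simp [gpComm]

theorem gpComm_eq_one_iff {x y : K} : gpComm x y = 1 ↔ Commute x y := by
  rw [commute_iff_eq, gpComm, mul_assoc, ← mul_inv_rev, inv_mul_eq_one, eq_comm]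

theorem gpComm_mem_commutator (x y : K) : gpComm x y ∈ commutator K := by
  have h := Subgroup.commutator_mem_commutator (Subgroup.mem_top x⁻¹) (Subgroup.mem_top y⁻¹)
  simpa [commutatorElement_def, gpComm, commutator_def] using h

theorem zpow_mul_zpow_of_commute_gpComm {a b : K} (ha : Commute (gpComm b a) a)
    (hb : Commute (gpComm b a) b) (i j : ℤ) :
    b ^ j * a ^ i = a ^ i * b ^ j * gpComm b a ^ (i * j) := by
  have h₁ : SemiconjBy b a (a * gpComm b a) := by
    rw [SemiconjBy, mul_assoc, hb.eq]
    simp [gpComm, mul_assoc]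
  have h₂ : SemiconjBy (a ^ i) (gpComm b a ^ i * b) b := by
    have h := h₁.zpow_right i
    rw [ha.symm.mul_zpow] at h
    rw [SemiconjBy, ← mul_assoc]
    exact h.eq.symm
  rw [← (h₂.zpow_right j).eq, (hb.zpow_left i).mul_zpow, ← zpow_mul,
    ((hb.zpow_left (i * j)).zpow_right j).eq, mul_assoc]

theorem mul_pow_of_mul_eq_mul_mul {u v d : K} (hu : Commute d u) (hv : Commute d v)
    (h : v * u = u * v * d) (k : ℕ) : (u * v) ^ k = u ^ k * v ^ k * d ^ k.choose 2 := by
  have key : ∀ k : ℕ, v ^ k * u = u * v ^ k * d ^ k := fun k ↦ by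
    have hs : SemiconjBy u (v * d) v := by rw [SemiconjBy, h, mul_assoc]
    rw [← (hs.pow_right k).eq, hv.symm.mul_pow, mul_assoc]
  induction k with
  | zero => simp
  | succ k ih =>
    have hd := ((hu.mul_right hv).pow_left (k.choose 2)).eq
    calc (u * v) ^ (k + 1) = u ^ k * v ^ k * (d ^ k.choose 2 * (u * v)) := by
          rw [pow_succ, ih, mul_assoc]
      _ = u ^ k * (v ^ k * u) * v * d ^ k.choose 2 := by rw [hd]; group
      _ = u ^ (k + 1) * v ^ k * (d ^ k * v) * d ^ k.choose 2 := by
          rw [key, pow_succ]; group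
      _ = u ^ (k + 1) * v ^ (k + 1) * d ^ (k + 1).choose 2 := by
          rw [(hv.pow_left k).eq, Nat.choose_succ_succ' k 1, Nat.choose_one_right, pow_add,
            pow_succ v]
          group

theorem exists_zpow_mul_zpow_mul_zpow {a b : K} (ha : Commute (gpComm b a) a)
    (hb : Commute (gpComm b a) b) (hgen : Subgroup.closure {a, b} = ⊤) (g : K) :
    ∃ i j k : ℤ, g = a ^ i * b ^ j * gpComm b a ^ k := by
  have hg : g ∈ Subgroup.closure {a, b} := hgen ▸ Subgroup.mem_top g
  have hright : ∀ i j k i' j' : ℤ, a ^ i * b ^ j * gpComm b a ^ k * (a ^ i' * b ^ j') =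
      a ^ (i + i') * b ^ (j + j') * gpComm b a ^ (i' * j + k) := fun i j k i' j' ↦ by
    have hc := ((ha.zpow_zpow k i').mul_right (hb.zpow_zpow k j')).eq
    calc a ^ i * b ^ j * gpComm b a ^ k * (a ^ i' * b ^ j')
        = a ^ i * (b ^ j * a ^ i') * b ^ j' * gpComm b a ^ k := by
          rw [mul_assoc _ (gpComm b a ^ k), hc]; simp only [mul_assoc]
      _ = a ^ i * a ^ i' * b ^ j * (gpComm b a ^ (i' * j) * b ^ j') * gpComm b a ^ k := by
          rw [zpow_mul_zpow_of_commute_gpComm ha hb]; simp only [mul_assoc]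
      _ = _ := by
          rw [(hb.zpow_zpow _ _).eq, zpow_add, zpow_add, zpow_add]; simp only [mul_assoc]
  induction hg using Subgroup.closure_induction_right with
  | one => exact ⟨0, 0, 0, by simp⟩
  | mul_right x hx y hy ih =>
    obtain ⟨i, j, k, rfl⟩ := ih
    rcases hy with rfl | rfl
    · exact ⟨_, _, _, by simpa using hright i j k 1 0⟩
    · exact ⟨_, _, _, by simpa using hright i j k 0 1⟩
  | mul_inv_cancel x hx y hy ih =>
    obtain ⟨i, j, k, rfl⟩ := ih
    rcases hy with rfl | rfl
    · exact ⟨_, _, _, by simpa using hright i j k (-1) 0⟩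
    · exact ⟨_, _, _, by simpa using hright i j k 0 (-1)⟩

theorem map_pow_eq_one_of_mem_omegaRel {A : Type*} [CommGroup A] (f : K →* A) {q : ℕ} {u : K}
    (hu : u ∈ omegaRel q (commutator K)) : f u ^ q = 1 := by
  have h : omegaRel q (commutator K) ≤ ((powMonoidHom q).comp f).ker := by
    refine (Subgroup.closure_le _).2 fun g hg ↦ ?_
    have := Abelianization.commutator_subset_ker f hg
    simpa [MonoidHom.mem_ker] using this
  simpa [MonoidHom.mem_ker] using h hu

theorem pow_mem_zpowers_of_mem_omegaRel {n m : ℕ} (hnm : m < n) {a b : K}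
    (ha : Commute (gpComm b a) a) (hb : Commute (gpComm b a) b)
    (hgen : Subgroup.closure {a, b} = ⊤) (hc : gpComm b a ^ 2 ^ m = 1) (han : a ^ 2 ^ n = 1)
    (f : K →* Multiplicative (ZMod (2 ^ n))) (hfa : f a = Multiplicative.ofAdd 1)
    (hfb : f b = 1) {u : K} (hu : u ∈ omegaRel (2 ^ m) (commutator K)) :
    u ^ 2 ^ m ∈ Subgroup.zpowers (b ^ 2 ^ m) := by
  have hfu := map_pow_eq_one_of_mem_omegaRel f hu
  obtain ⟨i, j, k, rfl⟩ := exists_zpow_mul_zpow_mul_zpow ha hb hgen u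
  have hdvd : (2 : ℤ) ^ n ∣ 2 ^ m * i := by
    rw [map_mul, map_mul, map_zpow, map_zpow, map_zpow, map_gpComm, hfa, hfb] at hfu
    have h₀ : ((2 ^ m * i : ℤ) : ZMod (2 ^ n)) = 0 := by
      have := congrArg Multiplicative.toAdd hfu
      simpa [gpComm] using this
    simpa using (ZMod.intCast_zmod_eq_zero_iff_dvd _ _).1 h₀
  have hieven : (2 : ℤ) ∣ i := by
    have h : (2 : ℤ) ^ m * 2 ∣ 2 ^ m * i := by
      rw [← pow_succ]
      exact (pow_dvd_pow 2 hnm).trans hdvd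
    exact (mul_dvd_mul_iff_left (by positivity)).1 h
  have hapow : (a ^ i) ^ 2 ^ m = 1 := by
    obtain ⟨t, ht⟩ := hdvd
    rw [← zpow_natCast, ← zpow_mul, mul_comm i]
    push_cast
    rw [ht, zpow_mul]
    have : a ^ ((2 : ℤ) ^ n) = 1 := by exact_mod_cast han
    rw [this, one_zpow]
  have hdpow : (gpComm b a ^ (i * j)) ^ (2 ^ m).choose 2 = 1 := by
    obtain ⟨i', rfl⟩ := hieven
    have h2 : 2 * (2 ^ m).choose 2 = 2 ^ m * (2 ^ m - 1) := by
      rw [Nat.choose_two_right]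
      exact Nat.mul_div_cancel' (Nat.even_mul_pred_self _).two_dvd
    have hexp : 2 * i' * j * ((2 ^ m).choose 2 : ℤ) =
        ((2 ^ m : ℕ) : ℤ) * (((2 ^ m - 1 : ℕ) : ℤ) * (i' * j)) := by
      have h2' : (2 * (2 ^ m).choose 2 : ℤ) = ((2 ^ m : ℕ) : ℤ) * ((2 ^ m - 1 : ℕ) : ℤ) := by
        exact_mod_cast h2
      linear_combination (i' * j) * h2'
    rw [← zpow_natCast, ← zpow_mul, hexp, zpow_mul, zpow_natCast, hc, one_zpow]
  refine Subgroup.mem_zpowers_iff.2 ⟨j, ?_⟩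
  rw [((ha.zpow_zpow k i).mul_right (hb.zpow_zpow k j)).symm.mul_pow,
    mul_pow_of_mul_eq_mul_mul (ha.zpow_zpow _ _) (hb.zpow_zpow _ _)
      (zpow_mul_zpow_of_commute_gpComm ha hb i j), hapow, hdpow, ← zpow_natCast (gpComm b a ^ k),
    zpow_comm (gpComm b a) k, zpow_natCast, hc]
  rw [one_zpow, one_mul, mul_one, mul_one, ← zpow_natCast, ← zpow_natCast, zpow_comm]

end ClassTwo

namespace ClassTwoCase3

theorem closure_of_eq_top (rels : Set (FreeGroup (Fin 2))) :
    Subgroup.closure {(PresentedGroup.of 0 : PresentedGroup rels), PresentedGroup.of 1} = ⊤ := by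
  rw [← PresentedGroup.closure_range_of rels]
  congr 1
  ext x
  simp [Fin.exists_fin_two, eq_comm]

/-- The translation `(t, z) ↦ (t + 1, z)`. -/
def shiftPerm (R : Type*) [CommRing R] : Equiv.Perm (R × R) where
  toFun p := (p.1 + 1, p.2)
  invFun p := (p.1 - 1, p.2)
  left_inv p := by simp
  right_inv p := by simp

/-- The shear `(t, z) ↦ (t, z + r * t + s)`. -/
def shearPerm {R : Type*} [CommRing R] (r s : R) : Equiv.Perm (R × R) where
  toFun p := (p.1, p.2 + (r * p.1 + s))
  invFun p := (p.1, p.2 - (r * p.1 + s))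
  left_inv p := by simp
  right_inv p := by simp

theorem shiftPerm_pow_apply {R : Type*} [CommRing R] (k : ℕ) (p : R × R) :
    (shiftPerm R ^ k) p = (p.1 + k, p.2) := by
  induction k with
  | zero => simp
  | succ k ih =>
    rw [pow_succ', Equiv.Perm.mul_apply, ih]
    simp [shiftPerm, add_assoc]

theorem shearPerm_pow {R : Type*} [CommRing R] (r s : R) (k : ℕ) :
    shearPerm r s ^ k = shearPerm (k * r) (k * s) := by
  induction k with
  | zero => ext p <;> simp [shearPerm]
  | succ k ih =>
    rw [pow_succ', ih]
    ext p
    · simp [shearPerm]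
    · simp [shearPerm]; ring

theorem gpComm_shearPerm_shiftPerm {R : Type*} [CommRing R] (r s : R) :
    gpComm (shearPerm r s) (shiftPerm R) = shearPerm 0 r := by
  ext p
  · simp [gpComm, shearPerm, shiftPerm, Equiv.Perm.inv_def]
  · simp [gpComm, shearPerm, shiftPerm, Equiv.Perm.inv_def]; ring

theorem commute_shearPerm_shiftPerm {R : Type*} [CommRing R] (s : R) :
    Commute (shearPerm 0 s) (shiftPerm R) := by
  ext p <;> simp [shearPerm, shiftPerm]

theorem commute_shearPerm {R : Type*} [CommRing R] (r s r' s' : R) :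
    Commute (shearPerm r s) (shearPerm r' s') := by
  ext p
  · simp [shearPerm]
  · simp [shearPerm]; ring

section

variable {rels : Set (FreeGroup (Fin 2))}

theorem mk_gpComm_gen :
    PresentedGroup.mk rels (gpComm gen1 gen0) =
      gpComm (PresentedGroup.of 1) (PresentedGroup.of 0) :=
  map_gpComm _ _ _

theorem commute_of_gpComm_mem {x y : FreeGroup (Fin 2)} (h : gpComm x y ∈ rels) :
    Commute (PresentedGroup.mk rels x) (PresentedGroup.mk rels y) := by
  rw [← gpComm_eq_one_iff, ← map_gpComm]
  exact PresentedGroup.one_of_mem h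

end

theorem two_pow_mul_two (m : ℕ) : (2 ^ m * 2 : ZMod (2 ^ (m + 1))) = 0 := by
  rw [← pow_succ]
  exact_mod_cast ZMod.natCast_self (2 ^ (m + 1))

theorem bG_pow_ne_one {n m : ℕ} (hm : 1 ≤ m) (hnm : m < n) : bG n m ^ 2 ^ m ≠ 1 := by
  let φ : Fin 2 → Equiv.Perm (ZMod (2 ^ (m + 1)) × ZMod (2 ^ (m + 1))) :=
    ![shiftPerm _, shearPerm 2 1]
  have h0 := two_pow_mul_two m
  have hpow : shearPerm (2 : ZMod (2 ^ (m + 1))) 1 ^ 2 ^ m = shearPerm 0 (2 ^ m) := by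
    rw [shearPerm_pow]; push_cast; rw [h0, mul_one]
  have hcomm : FreeGroup.lift φ (gpComm gen1 gen0) = shearPerm 0 2 := by
    rw [map_gpComm]
    simp [φ, gpComm_shearPerm_shiftPerm]
  have hφ : ∀ r ∈ Grels n m, FreeGroup.lift φ r = 1 := by
    rintro r (rfl | rfl | rfl | rfl | rfl)
    · rw [map_pow, hcomm, shearPerm_pow]
      push_cast
      rw [h0]
      ext p <;> simp [shearPerm]
    · rw [map_gpComm, hcomm, gpComm_eq_one_iff]
      simpa [φ] using commute_shearPerm_shiftPerm _
    · rw [map_gpComm, hcomm, gpComm_eq_one_iff]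
      simpa [φ] using commute_shearPerm _ _ _ _
    · have hn : (2 : ZMod (2 ^ (m + 1))) ^ n = 0 :=
        pow_eq_zero_of_le (Nat.succ_le_of_lt hnm) ((pow_succ _ _).trans h0)
      ext p <;> simp [φ, shiftPerm_pow_apply, hn]
    · rw [map_mul, map_inv, map_pow, map_pow, hcomm, mul_inv_eq_one, shearPerm_pow]
      have h2 : (2 : ZMod (2 ^ (m + 1))) ^ (m - 1) * 2 = 2 ^ m := by
        rw [← pow_succ, Nat.sub_add_cancel hm]
      push_cast
      rw [h2, mul_zero]
      simpa [φ] using hpow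
  intro h
  have h1 := congrArg (PresentedGroup.toGroup hφ) h
  rw [map_pow, map_one, PresentedGroup.toGroup.of] at h1
  have h2 : shearPerm (0 : ZMod (2 ^ (m + 1))) (2 ^ m) = 1 := by
    rw [← hpow]; simpa [φ] using h1
  have h3 : ((2 ^ m : ℕ) : ZMod (2 ^ (m + 1))) = 0 := by
    have := congrArg Prod.snd (Equiv.congr_fun h2 0)
    simpa [shearPerm] using this
  rw [ZMod.natCast_eq_zero_iff] at h3
  exact absurd (Nat.pow_dvd_pow_iff_le_right'.1 h3) (by omega)

/-- There is a homomorphism onto `ZMod (2 ^ n)` reading off the exponent of the first generator. -/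
theorem exists_hom_zmod {rels : Set (FreeGroup (Fin 2))} (n : ℕ)
    (h : ∀ r ∈ rels, FreeGroup.lift
      (![Multiplicative.ofAdd 1, 1] : Fin 2 → Multiplicative (ZMod (2 ^ n))) r = 1) :
    ∃ f : PresentedGroup rels →* Multiplicative (ZMod (2 ^ n)),
      f (PresentedGroup.of 0) = Multiplicative.ofAdd 1 ∧ f (PresentedGroup.of 1) = 1 :=
  ⟨PresentedGroup.toGroup h, by simp, by simp⟩

theorem lift_gpComm_eq_one {A : Type*} [CommGroup A] (φ : Fin 2 → A) (x y : FreeGroup (Fin 2)) :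
    FreeGroup.lift φ (gpComm x y) = 1 := by
  rw [map_gpComm, gpComm_eq_one_iff]
  exact Commute.all _ _

theorem ofAdd_one_pow (n : ℕ) :
    (Multiplicative.ofAdd 1 : Multiplicative (ZMod (2 ^ n))) ^ 2 ^ n = 1 := by
  rw [← ofAdd_nsmul, nsmul_one, ZMod.natCast_self, ofAdd_zero]

theorem pow_mem_zpowers_G {n m : ℕ} (hnm : m < n) {u : G n m}
    (hu : u ∈ omegaRel (2 ^ m) (commutator (G n m))) :
    u ^ 2 ^ m ∈ Subgroup.zpowers (bG n m ^ 2 ^ m) := by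
  obtain ⟨f, hfa, hfb⟩ := exists_hom_zmod (rels := Grels n m) n (by
    rintro r (rfl | rfl | rfl | rfl | rfl) <;> simp [lift_gpComm_eq_one, ofAdd_one_pow])
  refine pow_mem_zpowers_of_mem_omegaRel hnm ?_ ?_ (closure_of_eq_top _) ?_ ?_ f hfa hfb hu
  · exact mk_gpComm_gen (rels := Grels n m) ▸ commute_of_gpComm_mem (by simp [Grels])
  · exact mk_gpComm_gen (rels := Grels n m) ▸ commute_of_gpComm_mem (by simp [Grels])
  · rw [← mk_gpComm_gen, ← map_pow]
    exact PresentedGroup.one_of_mem (by simp [Grels])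
  · exact PresentedGroup.one_of_mem (x := gen0 ^ 2 ^ n) (by simp [Grels])

theorem pow_eq_one_H {n m : ℕ} (hnm : m < n) {u : H n m}
    (hu : u ∈ omegaRel (2 ^ m) (commutator (H n m))) : u ^ 2 ^ m = 1 := by
  obtain ⟨f, hfa, hfb⟩ := exists_hom_zmod (rels := Hrels n m) n (by
    rintro r (rfl | rfl | rfl | rfl | rfl) <;> simp [lift_gpComm_eq_one, ofAdd_one_pow])
  have hb : (PresentedGroup.of 1 : H n m) ^ 2 ^ m = 1 :=
    PresentedGroup.one_of_mem (x := gen1 ^ 2 ^ m) (by simp [Hrels])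
  suffices u ^ 2 ^ m ∈ Subgroup.zpowers ((PresentedGroup.of 1 : H n m) ^ 2 ^ m) by
    simpa [hb] using this
  refine pow_mem_zpowers_of_mem_omegaRel hnm ?_ ?_ (closure_of_eq_top _) ?_ ?_ f hfa hfb hu
  · exact mk_gpComm_gen (rels := Hrels n m) ▸ commute_of_gpComm_mem (by simp [Hrels])
  · exact mk_gpComm_gen (rels := Hrels n m) ▸ commute_of_gpComm_mem (by simp [Hrels])
  · rw [← mk_gpComm_gen, ← map_pow]
    exact PresentedGroup.one_of_mem (by simp [Hrels])
  · exact PresentedGroup.one_of_mem (x := gen0 ^ 2 ^ n) (by simp [Hrels])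

theorem bG_pow_eq (n m : ℕ) :
    bG n m ^ 2 ^ m = gpComm (bG n m) (PresentedGroup.of 0) ^ 2 ^ (m - 1) := by
  have h := PresentedGroup.one_of_mem (rels := Grels n m)
    (x := gen1 ^ 2 ^ m * (gpComm gen1 gen0 ^ 2 ^ (m - 1))⁻¹) (by simp [Grels])
  rw [map_mul, map_inv, map_pow, map_pow, mk_gpComm_gen, mul_inv_eq_one] at h
  exact h

theorem bG_mem_omegaRel (n m : ℕ) : bG n m ∈ omegaRel (2 ^ m) (commutator (G n m)) := by
  refine Subgroup.subset_closure ?_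
  rw [Set.mem_ofPred_eq, bG_pow_eq]
  exact pow_mem (gpComm_mem_commutator _ _) _

theorem orderOf_bG_pow {n m : ℕ} (hm : 1 ≤ m) (hnm : m < n) : orderOf (bG n m ^ 2 ^ m) = 2 := by
  refine orderOf_eq_prime ?_ (bG_pow_ne_one hm hnm)
  rw [bG_pow_eq, ← pow_mul, ← pow_succ, Nat.sub_add_cancel hm, ← mk_gpComm_gen, ← map_pow]
  exact PresentedGroup.one_of_mem (by simp [Grels])

theorem agemo_omegaRel_G {n m : ℕ} (hnm : m < n) :
    agemo (2 ^ m) (omegaRel (2 ^ m) (commutator (G n m))) =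
      Subgroup.closure {bG n m ^ 2 ^ m} := by
  refine le_antisymm ((Subgroup.closure_le _).2 ?_) ((Subgroup.closure_le _).2 ?_)
  · rintro _ ⟨u, hu, rfl⟩
    rw [← Subgroup.zpowers_eq_closure]
    exact pow_mem_zpowers_G hnm hu
  · rw [Set.singleton_subset_iff]
    exact Subgroup.subset_closure ⟨_, bG_mem_omegaRel n m, rfl⟩

end ClassTwoCase3

open ClassTwoCase3 in
/-- With `U = Ω_m(G:G')` and `V = Ω_m(H:H')`, the subgroup `℧_m(U)` equals `⟨b^{2^m}⟩` and
has order `2`, while `℧_m(V)` is trivial. -/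
theorem agemo_omega_distinguishes (n m : ℕ) (hm : 1 ≤ m) (hnm : m < n) :
    agemo (2 ^ m) (omegaRel (2 ^ m) (commutator (G n m))) =
        Subgroup.closure {bG n m ^ 2 ^ m} ∧
      Nat.card (agemo (2 ^ m) (omegaRel (2 ^ m) (commutator (G n m)))) = 2 ∧
      agemo (2 ^ m) (omegaRel (2 ^ m) (commutator (H n m))) = ⊥ := by
  refine ⟨agemo_omegaRel_G hnm, ?_, ?_⟩
  · rw [agemo_omegaRel_G hnm, ← Subgroup.zpowers_eq_closure, Nat.card_zpowers,
      orderOf_bG_pow hm hnm]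
  · refine Subgroup.closure_eq_bot_iff.2 ?_
    rintro _ ⟨u, hu, rfl⟩
    exact pow_eq_one_H hnm hu
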